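/- If a ∈ L^∞(ℝ,V(ℝ)) and f ∈ C_0^∞(ℝ), then |(a(x,D)f)(x)| ≤ 2 (S_* f)(x) ‖a(x,·)‖_V for almost every x ∈ ℝ, where a(x,D) is the pseudodifferential operator defined by the iterated integral (a(x,D)f)(x) := (1/2π) ∫_ℝ dλ ∫_ℝ a(x,λ) e^{i(x−y)λ} f(y) dy and S_* is the maximal singular integral operator. -/

import Mathlib

open MeasureTheory Filter Set Topology
open scoped ENNReal NNReal

noncomputable section

/-- The Fourier transform `f̂(λ) = ∫ f(x) e^{-ixλ} dx`. -/
def ftransform (f : ℝ → ℂ) (l : ℝ) : ℂ :=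
  ∫ x : ℝ, f x * Complex.exp (-(Complex.I * (x : ℂ) * (l : ℂ)))

/-- The truncated Fourier inversion integral `(S_{(a,b)}f)(x) = (1/2π) ∫_a^b f̂(λ) e^{ixλ} dλ`. -/
def SInt (a b : ℝ) (f : ℝ → ℂ) (x : ℝ) : ℂ :=
  (2 * Real.pi)⁻¹ • ∫ l in a..b, ftransform f l * Complex.exp (Complex.I * (x : ℂ) * (l : ℂ))

/-- The maximal singular integral operator `(S_* f)(x) = sup_{a<b} |(S_{(a,b)}f)(x)|`. -/
def Sstar (f : ℝ → ℂ) (x : ℝ) : ℝ≥0∞ :=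
  ⨆ (a : ℝ) (b : ℝ) (_ : a < b), (‖SInt a b f x‖₊ : ℝ≥0∞)

/-- Total variation of `u` over partitions with nodes in the set `s`. -/
def varOn (u : ℝ → ℂ) (s : Set ℝ) : ℝ≥0∞ :=
  ⨆ (m : ℕ) (x : Fin (m + 1) → ℝ) (_ : StrictMono x) (_ : ∀ k, x k ∈ s),
    ∑ k : Fin m, (‖u (x k.succ) - u (x k.castSucc)‖₊ : ℝ≥0∞)

/-- The total variation `V(u)` of `u` on `ℝ`. -/
def totalVar (u : ℝ → ℂ) : ℝ≥0∞ := varOn u Set.univ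

/-- The norm `‖u‖_V = ‖u‖_∞ + V(u)` of the Banach algebra `V(ℝ)`. -/
def bvNorm (u : ℝ → ℂ) : ℝ≥0∞ := (⨆ t : ℝ, (‖u t‖₊ : ℝ≥0∞)) + totalVar u

/-- Membership in `V(ℝ)`: finite total variation and left continuity. -/
def MemV (u : ℝ → ℂ) : Prop :=
  totalVar u < ∞ ∧ ∀ t : ℝ, Tendsto u (𝓝[<] t) (𝓝 (u t))

/-- Membership in `L^∞(ℝ, V(ℝ))`: every section `a(x,·)` lies in `V(ℝ)`, the map
`x ↦ a(x,·)` is essentially bounded and measurable in the sense of the Luzin property. -/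
def MemLinfV (a : ℝ → ℝ → ℂ) : Prop :=
  (∀ x, MemV (a x)) ∧
  (∃ C : ℝ≥0, ∀ᵐ x ∂(volume : Measure ℝ), bvNorm (a x) ≤ C) ∧
  (∀ K : Set ℝ, IsCompact K → ∀ δ : ℝ≥0∞, 0 < δ → ∃ K' ⊆ K, IsCompact K' ∧
    volume (K \ K') < δ ∧ ∀ x ∈ K', ∀ ε : ℝ≥0∞, 0 < ε → ∃ η > (0 : ℝ), ∀ x' ∈ K',
      |x' - x| < η → bvNorm (fun t => a x t - a x' t) < ε)

/-- The norm `‖a‖_{L^∞(ℝ,V(ℝ))} = ess sup_x ‖a(x,·)‖_V`. -/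
def LinfVNorm (a : ℝ → ℝ → ℂ) : ℝ≥0∞ := essSup (fun x => bvNorm (a x)) volume

/-- The pseudodifferential operator
`(a(x,D)f)(x) = (1/2π) ∫ dλ ∫ a(x,λ) e^{i(x-y)λ} f(y) dy` (iterated integral). -/
def pdo (a : ℝ → ℝ → ℂ) (f : ℝ → ℂ) (x : ℝ) : ℂ :=
  (2 * Real.pi)⁻¹ •
    ∫ l : ℝ, ∫ y : ℝ, a x l * Complex.exp (Complex.I * ((x : ℂ) - (y : ℂ)) * (l : ℂ)) * f y

theorem continuous_ftransform {f : ℝ → ℂ} (hf : Integrable f) : Continuous (ftransform f) := by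
  have hnorm (x l : ℝ) : ‖Complex.exp (-(Complex.I * (x : ℂ) * (l : ℂ)))‖ = 1 := by
    have : -(Complex.I * (x : ℂ) * (l : ℂ)) = ((-(x * l) : ℝ) : ℂ) * Complex.I := by
      push_cast; ring
    rw [this, Complex.norm_exp_ofReal_mul_I]
  refine continuous_of_dominated (bound := fun x => ‖f x‖) (fun l => ?_) (fun l => ?_)
    hf.norm (ae_of_all _ fun x => by fun_prop)
  · exact hf.aestronglyMeasurable.mul (by fun_prop : Continuous _).aestronglyMeasurable
  · exact ae_of_all _ fun x => by rw [norm_mul, hnorm, mul_one]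

theorem pdo_eq (a : ℝ → ℝ → ℂ) (f : ℝ → ℂ) (x : ℝ) :
    pdo a f x = (2 * Real.pi)⁻¹ •
      ∫ l : ℝ, a x l * (ftransform f l * Complex.exp (Complex.I * (x : ℂ) * (l : ℂ))) := by
  unfold pdo ftransform
  congr 2
  ext l
  rw [← integral_mul_const, ← integral_const_mul]
  congr 1
  ext y
  rw [show Complex.I * ((x : ℂ) - (y : ℂ)) * (l : ℂ)
      = -(Complex.I * (y : ℂ) * (l : ℂ)) + Complex.I * (x : ℂ) * (l : ℂ) by ring, Complex.exp_add]
  ring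

theorem sum_mul_sub_eq (v G : ℕ → ℂ) (h0 : G 0 = 0) (N : ℕ) :
    ∑ k ∈ Finset.range N, v k * (G (k + 1) - G k)
      = v N * G N - ∑ k ∈ Finset.range N, (v (k + 1) - v k) * G (k + 1) := by
  induction N with
  | zero => simp [h0]
  | succ n ih => rw [Finset.sum_range_succ, Finset.sum_range_succ, ih]; ring

/-- The values of `u` along a strictly increasing sequence are controlled by `bvNorm u`. -/
theorem norm_add_sum_le_bvNorm {u : ℝ → ℂ} (hu : bvNorm u ≠ ∞) {t : ℕ → ℝ} (ht : StrictMono t)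
    (N : ℕ) :
    ‖u (t N)‖ + ∑ k ∈ Finset.range N, ‖u (t (k + 1)) - u (t k)‖ ≤ (bvNorm u).toReal := by
  have hsum : (∑ k ∈ Finset.range N, (‖u (t (k + 1)) - u (t k)‖₊ : ℝ≥0∞)) ≤ totalVar u := by
    rw [Finset.sum_range]
    unfold totalVar varOn
    refine le_iSup_of_le N (le_iSup_of_le (fun k : Fin (N + 1) => t k) (le_iSup_of_le ?_
      (le_iSup_of_le (fun _ => mem_univ _) ?_)))
    · exact fun i j hij => ht hij
    · simp
  have h : (‖u (t N)‖₊ : ℝ≥0∞) + ∑ k ∈ Finset.range N, (‖u (t (k + 1)) - u (t k)‖₊ : ℝ≥0∞)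
      ≤ bvNorm u :=
    add_le_add (le_iSup (fun s : ℝ => (‖u s‖₊ : ℝ≥0∞)) (t N)) hsum
  have h' := ENNReal.toReal_mono hu h
  rw [← ENNReal.ofNNReal_finsetSum, ← ENNReal.coe_add, ENNReal.coe_toReal] at h'
  simpa using h'

theorem norm_le_bvNorm {u : ℝ → ℂ} (hu : bvNorm u ≠ ∞) (s : ℝ) : ‖u s‖ ≤ (bvNorm u).toReal := by
  have h := ENNReal.toReal_mono hu
    ((le_iSup (fun s : ℝ => (‖u s‖₊ : ℝ≥0∞)) s).trans le_self_add : _ ≤ bvNorm u)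
  simpa using h

/-- The last point of the grid `ℤ / (n + 1)` strictly to the left of `t`. -/
def gridPoint (n : ℕ) (t : ℝ) : ℝ := ((⌈t * (n + 1)⌉ - 1 : ℤ) : ℝ) / (n + 1)

theorem gridPoint_lt (n : ℕ) (t : ℝ) : gridPoint n t < t := by
  have hn : (0 : ℝ) < n + 1 := by positivity
  rw [gridPoint, div_lt_iff₀ hn]
  push_cast
  linarith [Int.ceil_lt_add_one (t * (n + 1))]

theorem sub_le_gridPoint (n : ℕ) (t : ℝ) : t - 1 / (n + 1) ≤ gridPoint n t := by
  have hn : (0 : ℝ) < n + 1 := by positivity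
  rw [gridPoint, le_div_iff₀ hn, sub_mul, div_mul_cancel₀ _ hn.ne']
  push_cast
  linarith [Int.le_ceil (t * (n + 1))]

theorem tendsto_gridPoint (t : ℝ) : Tendsto (fun n => gridPoint n t) atTop (𝓝[<] t) := by
  refine tendsto_nhdsWithin_iff.2 ⟨?_, .of_forall fun n => gridPoint_lt n t⟩
  refine tendsto_of_tendsto_of_tendsto_of_le_of_le ?_ tendsto_const_nhds
    (fun n => sub_le_gridPoint n t) (fun n => (gridPoint_lt n t).le)
  simpa using (tendsto_const_nhds (x := t)).sub (tendsto_one_div_add_atTop_nhds_zero_nat (𝕜 := ℝ))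

theorem gridPoint_eq {n : ℕ} {j : ℤ} {t : ℝ}
    (ht : t ∈ Ioc ((j : ℝ) / (n + 1)) (((j : ℝ) + 1) / (n + 1))) :
    gridPoint n t = (j : ℝ) / (n + 1) := by
  have hn : (0 : ℝ) < n + 1 := by positivity
  have h1 := (div_lt_iff₀ hn).1 ht.1
  have h2 := (le_div_iff₀ hn).1 ht.2
  have : ⌈t * (n + 1)⌉ = j + 1 := by
    rw [Int.ceil_eq_iff]
    push_cast
    constructor <;> linarith
  rw [gridPoint, this]
  push_cast
  ring

theorem measurable_comp_gridPoint (u : ℝ → ℂ) (n : ℕ) : Measurable fun t => u (gridPoint n t) := by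
  have h : Measurable fun z : ℤ => u (((z - 1 : ℤ) : ℝ) / (n + 1)) := measurable_from_top
  exact h.comp (Int.measurable_ceil.comp (measurable_id.mul_const _))

theorem norm_integral_gridPoint_le {u g : ℝ → ℂ} (hu : bvNorm u ≠ ∞) (hg : Continuous g) {C : ℝ}
    (hC : ∀ a b : ℝ, a ≤ b → ‖∫ l in a..b, g l‖ ≤ C) (m n : ℕ) :
    ‖∫ l in (-(m : ℝ))..m, u (gridPoint n l) * g l‖ ≤ C * (bvNorm u).toReal := by
  have hn : (0 : ℝ) < n + 1 := by positivity
  have hC0 : 0 ≤ C := by simpa using hC 0 0 le_rfl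
  set t : ℕ → ℝ := fun k => (((k : ℤ) - (m * (n + 1) : ℤ) : ℤ) : ℝ) / (n + 1) with ht
  have htmono : StrictMono t := fun i j hij => by
    have : (i : ℝ) < j := by exact_mod_cast hij
    simp only [ht]
    push_cast
    gcongr
  have ht_succ (k : ℕ) : t (k + 1) = ((((k : ℤ) - (m * (n + 1) : ℤ) : ℤ) : ℝ) + 1) / (n + 1) := by
    simp only [ht]
    push_cast
    ring
  set N : ℕ := 2 * m * (n + 1) with hN
  have ht0 : t 0 = -(m : ℝ) := by
    simp only [ht]
    push_cast
    field_simp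
    ring
  have htN : t N = m := by
    simp only [ht, hN]
    push_cast
    field_simp
    ring
  have hpiece (k : ℕ) : EqOn (fun l => u (gridPoint n l) * g l) (fun l => u (t k) * g l)
      (Set.uIoc (t k) (t (k + 1))) := by
    intro l hl
    rw [uIoc_of_le (htmono k.lt_succ_self).le, ht_succ] at hl
    simp only [gridPoint_eq hl, ht]
  have hint (a b : ℝ) : IntervalIntegrable g volume a b := hg.intervalIntegrable a b
  set G : ℕ → ℂ := fun k => ∫ l in t 0..t k, g l with hG
  have hsum : ∫ l in (-(m : ℝ))..m, u (gridPoint n l) * g l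
      = ∑ k ∈ Finset.range N, u (t k) * (G (k + 1) - G k) := by
    rw [← ht0, ← htN, ← intervalIntegral.sum_integral_adjacent_intervals]
    · refine Finset.sum_congr rfl fun k _ => ?_
      rw [intervalIntegral.integral_congr_ae (ae_of_all _ fun l hl => hpiece k hl),
        intervalIntegral.integral_const_mul, hG,
        intervalIntegral.integral_interval_sub_left (hint _ _) (hint _ _)]
    · intro k _
      exact ((hint _ _).const_mul (u (t k))).congr fun l hl => (hpiece k hl).symm
  have hGC (k : ℕ) : ‖G k‖ ≤ C := hC _ _ (htmono.monotone k.zero_le)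
  rw [hsum, sum_mul_sub_eq (fun k => u (t k)) G (by simp [hG]) N]
  calc ‖u (t N) * G N - ∑ k ∈ Finset.range N, (u (t (k + 1)) - u (t k)) * G (k + 1)‖
      ≤ ‖u (t N)‖ * C + ∑ k ∈ Finset.range N, ‖u (t (k + 1)) - u (t k)‖ * C := by
        refine (norm_sub_le _ _).trans (add_le_add ?_ ((norm_sum_le _ _).trans
          (Finset.sum_le_sum fun k _ => ?_)))
        · rw [norm_mul]
          exact mul_le_mul_of_nonneg_left (hGC _) (norm_nonneg _)
        · rw [norm_mul]
          exact mul_le_mul_of_nonneg_left (hGC _) (norm_nonneg _)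
    _ = C * (‖u (t N)‖ + ∑ k ∈ Finset.range N, ‖u (t (k + 1)) - u (t k)‖) := by
        rw [← Finset.sum_mul]
        ring
    _ ≤ C * (bvNorm u).toReal :=
        mul_le_mul_of_nonneg_left (norm_add_sum_le_bvNorm hu htmono N) hC0

/-- If all the integrals of `g` over bounded intervals are at most `C`, then the integral of `g`
against a left-continuous function `u` of bounded variation is at most `C * bvNorm u`. -/
theorem norm_integral_mul_le {u g : ℝ → ℂ} (hu : bvNorm u ≠ ∞)
    (hleft : ∀ t, Tendsto u (𝓝[<] t) (𝓝 (u t))) (hg : Continuous g) {C : ℝ}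
    (hC : ∀ a b : ℝ, a ≤ b → ‖∫ l in a..b, g l‖ ≤ C) :
    ‖∫ l, u l * g l‖ ≤ C * (bvNorm u).toReal := by
  have hC0 : 0 ≤ C := by simpa using hC 0 0 le_rfl
  by_cases hi : Integrable fun l => u l * g l
  swap
  · rw [integral_undef hi, norm_zero]
    positivity
  have hm (m : ℕ) : ‖∫ l in (-(m : ℝ))..m, u l * g l‖ ≤ C * (bvNorm u).toReal := by
    refine le_of_tendsto' (x := atTop) (Tendsto.norm ?_) fun n => norm_integral_gridPoint_le hu hg hC m n
    refine intervalIntegral.tendsto_integral_filter_of_dominated_convergence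
      (fun l => (bvNorm u).toReal * ‖g l‖) (.of_forall fun n => ?_) (.of_forall fun n => ?_) ?_ ?_
    · exact ((measurable_comp_gridPoint u n).mul hg.measurable).aestronglyMeasurable
    · refine ae_of_all _ fun l _ => ?_
      rw [norm_mul]
      exact mul_le_mul_of_nonneg_right (norm_le_bvNorm hu _) (norm_nonneg _)
    · exact (hg.norm.intervalIntegrable _ _).const_mul _
    · exact ae_of_all _ fun l _ => ((hleft l).comp (tendsto_gridPoint l)).mul_const _
  exact le_of_tendsto' (intervalIntegral_tendsto_integral hi
    (tendsto_neg_atTop_atBot.comp tendsto_natCast_atTop_atTop)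
    tendsto_natCast_atTop_atTop).norm hm

theorem norm_integral_le_Sstar {f : ℝ → ℂ} {x : ℝ} (hS : Sstar f x ≠ ∞) {a b : ℝ} (hab : a ≤ b) :
    ‖∫ l in a..b, ftransform f l * Complex.exp (Complex.I * (x : ℂ) * (l : ℂ))‖
      ≤ 2 * Real.pi * (Sstar f x).toReal := by
  rcases hab.eq_or_lt with rfl | hlt
  · rw [intervalIntegral.integral_same, norm_zero]
    positivity
  have h : (‖SInt a b f x‖₊ : ℝ≥0∞) ≤ Sstar f x :=
    le_iSup_of_le a (le_iSup_of_le b (le_iSup_of_le hlt le_rfl))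
  have h' := ENNReal.toReal_mono hS h
  rw [ENNReal.coe_toReal, coe_nnnorm, SInt, norm_smul, Real.norm_of_nonneg (by positivity)] at h'
  exact (inv_mul_le_iff₀ (by positivity)).1 h'

theorem nnnorm_pdo_le {a : ℝ → ℝ → ℂ} {f : ℝ → ℂ} {x : ℝ} (hf : Integrable f)
    (hx : bvNorm (a x) ≠ ∞) (hleft : ∀ t, Tendsto (a x) (𝓝[<] t) (𝓝 (a x t))) :
    (‖pdo a f x‖₊ : ℝ≥0∞) ≤ Sstar f x * bvNorm (a x) := by
  rcases eq_or_ne (bvNorm (a x)) 0 with h0 | h0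
  · have hz (l : ℝ) : a x l = 0 := by
      simpa [h0] using norm_le_bvNorm hx l
    simp [pdo, hz]
  by_cases hS : Sstar f x = ∞
  · simp [hS, ENNReal.top_mul h0]
  have hg : Continuous fun l : ℝ =>
      ftransform f l * Complex.exp (Complex.I * (x : ℂ) * (l : ℂ)) :=
    (continuous_ftransform hf).mul (by fun_prop)
  have h := norm_integral_mul_le hx hleft hg fun _ _ hab => norm_integral_le_Sstar hS hab
  rw [← ENNReal.toReal_le_toReal ENNReal.coe_ne_top (ENNReal.mul_ne_top hS hx),
    ENNReal.coe_toReal, coe_nnnorm, ENNReal.toReal_mul, pdo_eq, norm_smul,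
    Real.norm_of_nonneg (by positivity), inv_mul_le_iff₀ (by positivity), ← mul_assoc]
  exact h

/-- Yu. Karlovich's pointwise estimate. If
`a ∈ L^∞(ℝ, V(ℝ))` and `f ∈ C_0^∞(ℝ)`, then
`|(a(x,D)f)(x)| ≤ 2 (S_* f)(x) ‖a(x,·)‖_V` for a.e. `x ∈ ℝ`. -/
theorem pdo_pointwise_estimate (a : ℝ → ℝ → ℂ) (ha : MemLinfV a)
    (f : ℝ → ℂ) (hf : ContDiff ℝ (⊤ : ℕ∞) f) (hf' : HasCompactSupport f) :
    ∀ᵐ x ∂(volume : Measure ℝ),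
      (‖pdo a f x‖₊ : ℝ≥0∞) ≤ 2 * Sstar f x * bvNorm (a x) := by
  filter_upwards [ha.2.1.choose_spec] with x hx
  have hfi : Integrable f := hf.continuous.integrable_of_hasCompactSupport hf'
  refine (nnnorm_pdo_le hfi (ne_top_of_le_ne_top ENNReal.coe_ne_top hx) (ha.1 x).2).trans ?_
  gcongr
  exact le_mul_of_one_le_left zero_le one_le_two
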